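/- arXiv:2406.02967 — 2 statements merged into one kernel-verified Lean document; each statement's English description precedes it below -/
import Mathlib

section
/- Let (A, B, H) be a P-module with H finite-dimensional. Then either every nonzero vector ξ ∈ H satisfies lim_{n→∞} ‖qₙξ‖ = 0 for all rays q, or there exists a nonzero vector η ∈ H and a periodic ray p such that ‖pₙη‖ = ‖η‖ for all n. -/
open Filter Topology
open scoped InnerProductSpace

/-- Action of a finite binary word on a vector: digit `false` acts by `A`,
digit `true` by `B`, with the first digit acting first. -/
noncomputable def wordAct {H : Type*} [NormedAddCommGroup H] [InnerProductSpace ℂ H]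
    (A B : H →L[ℂ] H) : List Bool → H → H
  | [], ξ => ξ
  | b :: rest, ξ => wordAct A B rest ((if b then B else A) ξ)

/-- The length-`n` prefix of a ray `p : ℕ → Bool` as a list. -/
def pre (p : ℕ → Bool) (n : ℕ) : List Bool := List.ofFn fun i : Fin n => p i

/-- The Pythagorean equality `A*A + B*B = id`. -/
def IsPyth {H : Type*} [NormedAddCommGroup H] [InnerProductSpace ℂ H] [CompleteSpace H]
    (A B : H →L[ℂ] H) : Prop :=
  (ContinuousLinearMap.adjoint A).comp A + (ContinuousLinearMap.adjoint B).comp B =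
    ContinuousLinearMap.id ℂ H

/-- `ξ` is a nonzero vector contained in the ray `p`. -/
noncomputable def ContainedIn {H : Type*} [NormedAddCommGroup H] [InnerProductSpace ℂ H]
    (A B : H →L[ℂ] H) (p : ℕ → Bool) (ξ : H) : Prop :=
  ξ ≠ 0 ∧ ∀ n : ℕ, ‖wordAct A B (pre p n) ξ‖ = ‖ξ‖

section PythagoreanModule

variable {H : Type*} [NormedAddCommGroup H] [InnerProductSpace ℂ H]

theorem wordAct_pre_succ (A B : H →L[ℂ] H) (p : ℕ → Bool) (n : ℕ) (ξ : H) :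
    wordAct A B (pre p (n + 1)) ξ =
      wordAct A B (pre (fun i => p (i + 1)) n) ((if p 0 then B else A) ξ) := by
  simp [pre, List.ofFn_succ, wordAct]

theorem wordAct_pre_add (A B : H →L[ℂ] H) (p : ℕ → Bool) (m n : ℕ) (ξ : H) :
    wordAct A B (pre p (m + n)) ξ =
      wordAct A B (pre (fun i => p (i + m)) n) (wordAct A B (pre p m) ξ) := by
  induction m generalizing p ξ with
  | zero => simp [pre, wordAct]
  | succ m ih =>
    rw [show m + 1 + n = (m + n) + 1 by ring, wordAct_pre_succ, ih, wordAct_pre_succ]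
    simp only [add_assoc, add_comm, add_left_comm]

theorem continuous_wordAct (A B : H →L[ℂ] H) (w : List Bool) : Continuous (wordAct A B w) := by
  induction w with
  | nil => exact continuous_id
  | cons b w ih => exact ih.comp (if b then B else A).continuous

theorem ContainedIn.shift {A B : H →L[ℂ] H} {p : ℕ → Bool} {ξ : H}
    (h : ContainedIn A B p ξ) (m : ℕ) :
    ContainedIn A B (fun i => p (i + m)) (wordAct A B (pre p m) ξ) := by
  refine ⟨?_, fun n => ?_⟩
  · rw [← norm_ne_zero_iff, h.2]
    exact norm_ne_zero_iff.2 h.1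
  · rw [← wordAct_pre_add, h.2, h.2]

variable [FiniteDimensional ℂ H]

theorem IsPyth.inner_add_inner {A B : H →L[ℂ] H} (hAB : IsPyth A B) (ξ ζ : H) :
    ⟪A ξ, A ζ⟫_ℂ + ⟪B ξ, B ζ⟫_ℂ = ⟪ξ, ζ⟫_ℂ := by
  have h := congrArg (fun T : H →L[ℂ] H => ⟪ξ, T ζ⟫_ℂ) hAB
  simpa [inner_add_right, ContinuousLinearMap.adjoint_inner_right] using h

theorem IsPyth.norm_sq_add_norm_sq {A B : H →L[ℂ] H} (hAB : IsPyth A B) (ξ : H) :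
    ‖A ξ‖ ^ 2 + ‖B ξ‖ ^ 2 = ‖ξ‖ ^ 2 := by
  have h := hAB.inner_add_inner ξ ξ
  simp only [inner_self_eq_norm_sq_to_K] at h
  exact_mod_cast h

theorem IsPyth.norm_wordAct_le {A B : H →L[ℂ] H} (hAB : IsPyth A B) (w : List Bool) (ξ : H) :
    ‖wordAct A B w ξ‖ ≤ ‖ξ‖ := by
  induction w generalizing ξ with
  | nil => exact le_rfl
  | cons b w ih =>
    refine (ih _).trans (le_of_sq_le_sq ?_ (norm_nonneg _))
    have h := hAB.norm_sq_add_norm_sq ξ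
    cases b <;> simp <;> nlinarith [sq_nonneg ‖A ξ‖, sq_nonneg ‖B ξ‖]

/-- The digit not chosen by a ray containing `ξ` kills `ξ`. -/
theorem IsPyth.other_digit_eq_zero {A B : H →L[ℂ] H} (hAB : IsPyth A B) {p : ℕ → Bool} {ξ : H}
    (h : ContainedIn A B p ξ) : (if p 0 then A else B) ξ = 0 := by
  have h₁ := h.2 1
  have h₂ := hAB.norm_sq_add_norm_sq ξ
  rw [wordAct_pre_succ] at h₁
  rw [← norm_eq_zero, ← sq_eq_zero_iff]
  cases hp : p 0 <;> simp [hp, pre, wordAct] at h₁ ⊢ <;> simpa [h₁] using h₂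

/-- Vectors contained in distinct rays are orthogonal. -/
theorem IsPyth.inner_eq_zero_of_ne {A B : H →L[ℂ] H} (hAB : IsPyth A B) {p q : ℕ → Bool}
    {ξ ζ : H} (hξ : ContainedIn A B p ξ) (hζ : ContainedIn A B q ζ) (hpq : p ≠ q) :
    ⟪ξ, ζ⟫_ℂ = 0 := by
  obtain ⟨n, hn⟩ := Function.ne_iff.1 hpq
  clear hpq
  induction n generalizing p q ξ ζ with
  | zero =>
    have h₁ := hAB.other_digit_eq_zero hξ
    have h₂ := hAB.other_digit_eq_zero hζ
    rw [← hAB.inner_add_inner]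
    cases hp : p 0 <;> cases hq : q 0 <;> simp_all
  | succ n ih =>
    have h₁ := hAB.other_digit_eq_zero hξ
    have h₂ := hAB.other_digit_eq_zero hζ
    have h₃ := ih (hξ.shift 1) (hζ.shift 1) hn
    rw [wordAct_pre_succ, wordAct_pre_succ] at h₃
    rw [← hAB.inner_add_inner]
    cases hp : p 0 <;> cases hq : q 0 <;> simp_all [pre, wordAct]

theorem IsPyth.exists_periodic_of_containedIn {A B : H →L[ℂ] H} (hAB : IsPyth A B)
    {p : ℕ → Bool} {ξ : H} (h : ContainedIn A B p ξ) :
    ∃ (η : H) (r : ℕ → Bool), (∃ d : ℕ, 0 < d ∧ ∀ n : ℕ, r (n + d) = r n) ∧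
      ContainedIn A B r η := by
  obtain ⟨m, n, hmn, hlt⟩ : ∃ m n : ℕ, (fun i => p (i + m)) = (fun i => p (i + n)) ∧ m < n := by
    by_contra! hne
    have hinj : Function.Injective fun m : ℕ => fun i => p (i + m) := fun m n hmn =>
      le_antisymm (hne n m hmn.symm) (hne m n hmn)
    have hli : LinearIndependent ℂ fun m : ℕ => wordAct A B (pre p m) ξ :=
      linearIndependent_of_ne_zero_of_inner_eq_zero (fun m => (h.shift m).1) fun m n hmn =>
        hAB.inner_eq_zero_of_ne (h.shift m) (h.shift n) (hinj.ne hmn)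
    exact not_finite_iff_infinite.2 (inferInstanceAs (Infinite ℕ)) hli.finite_of_isNoetherian
  refine ⟨_, _, ⟨n - m, by omega, fun i => ?_⟩, h.shift m⟩
  have hi : p (i + m) = p (i + n) := congrFun hmn i
  change p (i + (n - m) + m) = p (i + m)
  rw [hi, add_assoc, Nat.sub_add_cancel hlt.le]

theorem IsPyth.exists_containedIn_of_not_tendsto {A B : H →L[ℂ] H} (hAB : IsPyth A B)
    {q : ℕ → Bool} {ξ : H}
    (h : ¬ Tendsto (fun n : ℕ => ‖wordAct A B (pre q n) ξ‖) atTop (𝓝 0)) :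
    ∃ (p : ℕ → Bool) (η : H), ContainedIn A B p η := by
  have hanti : Antitone fun n : ℕ => ‖wordAct A B (pre q n) ξ‖ := by
    refine antitone_nat_of_succ_le fun n => ?_
    rw [wordAct_pre_add]
    exact hAB.norm_wordAct_le _ _
  obtain ⟨c, hc⟩ : ∃ c, Tendsto (fun n : ℕ => ‖wordAct A B (pre q n) ξ‖) atTop (𝓝 c) :=
    ⟨_, tendsto_atTop_ciInf hanti ⟨0, by rintro _ ⟨n, rfl⟩; exact norm_nonneg _⟩⟩
  have hc₀ : c ≠ 0 := by
    rintro rfl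
    exact h hc
  have : ProperSpace H := FiniteDimensional.proper ℂ H
  obtain ⟨⟨η, p⟩, -, φ, hφ, hlim⟩ :=
    ((isCompact_closedBall (0 : H) ‖ξ‖).prod (isCompact_univ (X := ℕ → Bool))).tendsto_subseq
      (x := fun n => (wordAct A B (pre q n) ξ, fun i => q (i + n)))
      fun n => by simpa using hAB.norm_wordAct_le _ _
  rw [Prod.tendsto_iff] at hlim
  obtain ⟨hη, hp⟩ := hlim
  have key (m : ℕ) : ‖wordAct A B (pre p m) η‖ = c := by
    have h₁ := (((continuous_wordAct A B (pre p m)).norm.tendsto η).comp hη)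
    have h₂ : Tendsto (fun k => ‖wordAct A B (pre q (φ k + m)) ξ‖) atTop (𝓝 c) :=
      hc.comp (tendsto_atTop_mono (fun k => Nat.le_add_right (φ k) m) hφ.tendsto_atTop)
    refine tendsto_nhds_unique_of_eventuallyEq h₁ h₂ ?_
    have h₃ : ∀ᶠ k in atTop, ∀ i : Fin m, q (i + φ k) = p i := by
      rw [eventually_all]
      intro i
      have := tendsto_pi_nhds.1 hp i
      rw [nhds_discrete, tendsto_pure] at this
      exact this
    filter_upwards [h₃] with k hk
    have hpre : pre p m = pre (fun i => q (i + φ k)) m := by simp [pre, hk]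
    simp only [Function.comp_apply]
    rw [wordAct_pre_add, hpre]
  have hηc : ‖η‖ = c := key 0
  exact ⟨p, η, norm_ne_zero_iff.1 (hηc ▸ hc₀), fun n => (key n).trans hηc.symm⟩

end PythagoreanModule

theorem stmt6 {H : Type*} [NormedAddCommGroup H] [InnerProductSpace ℂ H]
    [FiniteDimensional ℂ H] (A B : H →L[ℂ] H) (hAB : IsPyth A B) :
    (∀ ξ : H, ξ ≠ 0 → ∀ q : ℕ → Bool,
        Tendsto (fun n : ℕ => ‖wordAct A B (pre q n) ξ‖) atTop (𝓝 0)) ∨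
      (∃ (η : H) (p : ℕ → Bool), (∃ d : ℕ, 0 < d ∧ ∀ n : ℕ, p (n + d) = p n) ∧
        ContainedIn A B p η) := by
  by_cases h : ∃ (p : ℕ → Bool) (η : H), ContainedIn A B p η
  · obtain ⟨p, η, hη⟩ := h
    exact Or.inr (hAB.exists_periodic_of_containedIn hη)
  · exact Or.inl fun ξ _ q => by_contra fun hq => h (hAB.exists_containedIn_of_not_tendsto hq)
end

section
/- Every finite-dimensional P-module (A, B, H) admits a decomposition H = H₁ ⊕ ... ⊕ Hₙ ⊕ Z into mutually orthogonal subspaces, where each Hᵢ is a subspace invariant under A and B on which the restricted P-module is irreducible (contains no proper nonzero A,B-invariant subspace), and Z is a subspace containing no nonzero A,B-invariant subspace. -/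
open Filter Topology
open scoped InnerProductSpace

/-- Among the nonzero subspaces of `K` with a property `P`, there is a minimal one as soon as
there is one at all. -/
theorem exists_minimal_submodule_le {H : Type*} [NormedAddCommGroup H] [InnerProductSpace ℂ H]
    [FiniteDimensional ℂ H] (P : Submodule ℂ H → Prop) {K W : Submodule ℂ H}
    (hWK : W ≤ K) (hW : P W) (hW0 : W ≠ ⊥) :
    ∃ M ≤ K, P M ∧ M ≠ ⊥ ∧ ∀ U ≤ M, P U → U = ⊥ ∨ U = M := by
  obtain ⟨M, ⟨hMK, hM, hM0⟩, hmin⟩ := (wellFounded_lt (α := Submodule ℂ H)).has_min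
    {M | M ≤ K ∧ P M ∧ M ≠ ⊥} ⟨W, hWK, hW, hW0⟩
  refine ⟨M, hMK, hM, hM0, fun U hU hPU => ?_⟩
  by_contra! h
  exact hmin U ⟨hU.trans hMK, hPU, h.1⟩ (lt_of_le_of_ne hU h.2)

/-- For any property `P` of subspaces, every subspace `K` is the orthogonal sum of finitely many
minimal nonzero subspaces satisfying `P` and a remainder containing no such subspace. -/
theorem exists_orthogonal_decomposition_minimal {H : Type*} [NormedAddCommGroup H]
    [InnerProductSpace ℂ H] [FiniteDimensional ℂ H] (P : Submodule ℂ H → Prop)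
    (K : Submodule ℂ H) :
    ∃ (n : ℕ) (V : Fin n → Submodule ℂ H) (Z : Submodule ℂ H),
      (∀ i, V i ≠ ⊥) ∧
      (∀ i, P (V i)) ∧
      (∀ i, ∀ W ≤ V i, P W → W = ⊥ ∨ W = V i) ∧
      (∀ W ≤ Z, P W → W = ⊥) ∧
      (∀ i j, i ≠ j → V i ⟂ V j) ∧
      (∀ i, V i ⟂ Z) ∧
      (⨆ i, V i) ⊔ Z = K := by
  induction K using (wellFounded_lt (α := Submodule ℂ H)).induction with
  | _ K ih =>
  by_cases h : ∀ W ≤ K, P W → W = ⊥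
  · exact ⟨0, Fin.elim0, K, fun i => i.elim0, fun i => i.elim0, fun i => i.elim0, h,
      fun i => i.elim0, fun i => i.elim0, by simp⟩
  push Not at h
  obtain ⟨W, hWK, hW, hW0⟩ := h
  obtain ⟨M, hMK, hM, hM0, hmin⟩ := exists_minimal_submodule_le P hWK hW hW0
  have hlt : Mᗮ ⊓ K < K := by
    refine lt_of_le_of_ne inf_le_right fun heq => hM0 ?_
    have hle : M ≤ Mᗮ := hMK.trans (inf_eq_right.mp heq)
    exact Submodule.isOrtho_self.mp hle
  obtain ⟨n, V, Z, hV0, hV, hVmin, hZ, hVV, hVZ, hsup⟩ := ih _ hlt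
  have hMV : ∀ i, M ⟂ V i := fun i => Submodule.IsOrtho.symm
    ((le_iSup V i).trans (le_sup_left.trans (hsup.le.trans inf_le_left)))
  have hMZ : M ⟂ Z := Submodule.IsOrtho.symm (le_sup_right.trans (hsup.le.trans inf_le_left))
  refine ⟨n + 1, Fin.cons M V, Z, ?_, ?_, ?_, hZ, ?_, ?_, ?_⟩
  · exact Fin.cases hM0 hV0
  · exact Fin.cases hM hV
  · exact Fin.cases hmin hVmin
  · refine Fin.cases (Fin.cases (fun h => absurd rfl h) fun j _ => hMV j) fun i =>
      Fin.cases (fun _ => (hMV i).symm) fun j hij => hVV i j fun h => hij (h ▸ rfl)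
  · exact Fin.cases hMZ hVZ
  · have hcons : (⨆ i, (Fin.cons M V : Fin (n + 1) → Submodule ℂ H) i) = M ⊔ ⨆ i, V i := by
      refine le_antisymm (iSup_le (Fin.cases le_sup_left fun i =>
        (le_iSup V i).trans le_sup_right)) (sup_le ?_ (iSup_le fun i => ?_))
      · exact le_iSup (Fin.cons M V : Fin (n + 1) → Submodule ℂ H) 0
      · exact le_iSup (Fin.cons M V : Fin (n + 1) → Submodule ℂ H) i.succ
    rw [hcons, sup_assoc, hsup]
    exact Submodule.sup_orthogonal_inf_of_hasOrthogonalProjection hMK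

theorem stmt10 {H : Type*} [NormedAddCommGroup H] [InnerProductSpace ℂ H]
    [FiniteDimensional ℂ H] (A B : H →L[ℂ] H) (hAB : IsPyth A B) :
    ∃ (n : ℕ) (V : Fin n → Submodule ℂ H) (Z : Submodule ℂ H),
      (∀ i, V i ≠ ⊥) ∧
      (∀ i, ∀ x ∈ V i, A x ∈ V i ∧ B x ∈ V i) ∧
      (∀ i, ∀ W : Submodule ℂ H, W ≤ V i → (∀ x ∈ W, A x ∈ W ∧ B x ∈ W) →
        W = ⊥ ∨ W = V i) ∧
      (∀ W : Submodule ℂ H, W ≤ Z → (∀ x ∈ W, A x ∈ W ∧ B x ∈ W) → W = ⊥) ∧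
      (∀ i j, i ≠ j → ∀ x ∈ V i, ∀ y ∈ V j, ⟪x, y⟫_ℂ = 0) ∧
      (∀ i, ∀ x ∈ V i, ∀ z ∈ Z, ⟪x, z⟫_ℂ = 0) ∧
      (⨆ i, V i) ⊔ Z = ⊤ := by
  obtain ⟨n, V, Z, hV0, hV, hVmin, hZ, hVV, hVZ, hsup⟩ :=
    exists_orthogonal_decomposition_minimal (fun W => ∀ x ∈ W, A x ∈ W ∧ B x ∈ W) ⊤
  exact ⟨n, V, Z, hV0, hV, hVmin, hZ,
    fun i j hij _ hx _ hy => (hVV i j hij).inner_eq hx hy,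
    fun i _ hx _ hz => (hVZ i).inner_eq hx hz, hsup⟩
end
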